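/- Let n and p be positive integers with 1 ≤ p ≤ n−3, and let G be a connected simple graph with n vertices and exactly p pendant vertices whose sigma index σ(G) is maximal among all connected graphs with n vertices and p pendant vertices. Then the maximum degree of G is n−1. -/

import Mathlib

open Finset
open scoped Classical

/-- The sigma irregularity index: the sum over all edges of the squared
difference of the endpoint degrees. -/
noncomputable def sigmaIndex {V : Type*} [Fintype V] (G : SimpleGraph V) : ℤ :=
  ∑ e ∈ G.edgeFinset,
    Sym2.lift ⟨fun u v => ((G.degree u : ℤ) - (G.degree v : ℤ)) ^ 2,
      fun u v => by ring⟩ e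

theorem connected_of_adj_reachable {V : Type*} {G H : SimpleGraph V} (hG : G.Connected)
    (h : ∀ a b, G.Adj a b → H.Reachable a b) : H.Connected := by
  have := hG.nonempty
  refine ⟨fun a b => ?_⟩
  obtain ⟨w⟩ := hG.preconnected a b
  induction w with
  | nil => exact SimpleGraph.Reachable.refl _
  | cons hab _ ih => exact (h _ _ hab).trans ih

theorem exists_adj_of_not_dominating {V : Type*} {G : SimpleGraph V} (hG : G.Connected) {v w : V} (hwv : w ≠ v)
    (hnvw : ¬ G.Adj v w) : ∃ u x, G.Adj u v ∧ G.Adj u x ∧ x ≠ v ∧ ¬ G.Adj v x := by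
  obtain ⟨p⟩ := hG.preconnected v w
  obtain ⟨d, -, h1, h2⟩ := p.exists_boundary_dart {x | x = v ∨ G.Adj v x} (Or.inl rfl)
    (by simp [hwv, hnvw])
  simp only [Set.mem_ofPred_eq, not_or] at h1 h2
  have hd := d.adj
  refine ⟨d.fst, d.snd, ?_, hd, h2.1, h2.2⟩
  rcases h1 with h | h
  · exact absurd (h ▸ hd) h2.2
  · exact h.symm

variable {V : Type*} [Fintype V]

theorem two_mul_sigmaIndex (G : SimpleGraph V) :
    2 * sigmaIndex G =
      ∑ a, ∑ b, G.adjMatrix ℤ a b * ((G.degree a : ℤ) - G.degree b) ^ 2 := by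
  set f : Sym2 V → ℤ := Sym2.lift ⟨fun u v => ((G.degree u : ℤ) - (G.degree v : ℤ)) ^ 2,
      fun u v => by ring⟩ with hf
  have hsum : ∑ a, ∑ b, G.adjMatrix ℤ a b * ((G.degree a : ℤ) - G.degree b) ^ 2
      = ∑ x ∈ (univ : Finset (V × V)).filter (fun x => G.Adj x.1 x.2), f s(x.1, x.2) := by
    rw [← Fintype.sum_prod_type', Finset.sum_filter]
    refine Finset.sum_congr rfl fun x _ => ?_
    simp [SimpleGraph.adjMatrix_apply, hf]
  rw [hsum, ← Finset.sum_fiberwise_of_maps_to (t := G.edgeFinset) (g := fun x => s(x.1, x.2))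
    (by intro x hx; simpa using hx), sigmaIndex, Finset.mul_sum]
  refine Finset.sum_congr rfl fun e he => ?_
  induction e using Sym2.ind with
  | _ a b =>
    have hab : G.Adj a b := by simpa using he
    have hfib : ((univ : Finset (V × V)).filter (fun x => G.Adj x.1 x.2)).filter
        (fun x => s(x.1, x.2) = s(a, b)) = {(a, b), (b, a)} := by
      ext ⟨x, y⟩
      simp only [mem_filter, mem_univ, true_and, Sym2.eq_iff, mem_insert, mem_singleton,
        Prod.mk.injEq]
      constructor
      · exact fun h => h.2
      · rintro (⟨rfl, rfl⟩ | ⟨rfl, rfl⟩)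
        · exact ⟨hab, Or.inl ⟨rfl, rfl⟩⟩
        · exact ⟨hab.symm, Or.inr ⟨rfl, rfl⟩⟩
    rw [hfib, Finset.sum_pair (by simp [hab.ne])]
    rw [Sym2.eq_swap (a := b)]
    ring

theorem sum_adjMatrix_eq_degree (G : SimpleGraph V) (a : V) :
    ∑ b, G.adjMatrix ℤ a b = G.degree a := by
  simp [SimpleGraph.adjMatrix_apply, ← SimpleGraph.card_neighborFinset_eq_degree,
    SimpleGraph.neighborFinset_eq_filter]

/-- The graph Laplacian applied to the degree function. -/
noncomputable def degreeLaplacian (G : SimpleGraph V) (a : V) : ℤ :=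
  ∑ b, G.adjMatrix ℤ a b * ((G.degree a : ℤ) - G.degree b)

/-- The change of the sigma index when the adjacency matrix changes by `M`
and the degrees change by `h`. -/
theorem two_mul_sigmaIndex_perturb (G H : SimpleGraph V) (M : V → V → ℤ) (h : V → ℤ)
    (hM : ∀ a b, H.adjMatrix ℤ a b = G.adjMatrix ℤ a b + M a b)
    (hd : ∀ a, (H.degree a : ℤ) = G.degree a + h a) :
    2 * sigmaIndex H = 2 * sigmaIndex G + 4 * ∑ a, h a * degreeLaplacian G a
      + ∑ a, ∑ b, G.adjMatrix ℤ a b * (h a - h b) ^ 2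
      + ∑ a, ∑ b, M a b * ((H.degree a : ℤ) - H.degree b) ^ 2 := by
  have hL : 4 * ∑ a, h a * degreeLaplacian G a = ∑ a, ∑ b, 2 * (G.adjMatrix ℤ a b *
      ((G.degree a : ℤ) - G.degree b) * (h a - h b)) := by
    have h1 : ∑ a, h a * degreeLaplacian G a =
        ∑ a, ∑ b, G.adjMatrix ℤ a b * ((G.degree a : ℤ) - G.degree b) * h a := by
      refine Finset.sum_congr rfl fun a _ => ?_
      rw [degreeLaplacian, Finset.mul_sum]
      exact Finset.sum_congr rfl fun b _ => by ring
    have h2 : ∑ a, h a * degreeLaplacian G a =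
        ∑ a, ∑ b, -(G.adjMatrix ℤ a b * ((G.degree a : ℤ) - G.degree b) * h b) := by
      rw [h1, Finset.sum_comm]
      refine Finset.sum_congr rfl fun a _ => Finset.sum_congr rfl fun b _ => ?_
      simp only [SimpleGraph.adjMatrix_apply, G.adj_comm b a]
      ring
    have h3 : 4 * ∑ a, h a * degreeLaplacian G a = 2 * (∑ a, h a * degreeLaplacian G a +
        ∑ a, h a * degreeLaplacian G a) := by ring
    rw [h3]
    nth_rewrite 1 [h1]
    rw [h2, ← Finset.sum_add_distrib, Finset.mul_sum]
    refine Finset.sum_congr rfl fun a _ => ?_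
    rw [← Finset.sum_add_distrib, Finset.mul_sum]
    exact Finset.sum_congr rfl fun b _ => by ring
  rw [hL, two_mul_sigmaIndex, two_mul_sigmaIndex]
  simp only [← Finset.sum_add_distrib]
  refine Finset.sum_congr rfl fun a _ => Finset.sum_congr rfl fun b _ => ?_
  rw [hM, hd, hd]
  ring

theorem adjMatrix_mul_sq_sum_nonneg (G : SimpleGraph V) (h : V → ℤ) :
    0 ≤ ∑ a, ∑ b, G.adjMatrix ℤ a b * (h a - h b) ^ 2 := by
  refine Finset.sum_nonneg fun a _ => Finset.sum_nonneg fun b _ => ?_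
  rw [SimpleGraph.adjMatrix_apply]
  split_ifs <;> positivity

theorem adjMatrix_mul_sq_sum_pos (G : SimpleGraph V) (h : V → ℤ) {u v : V} (huv : G.Adj u v)
    (hne : h u ≠ h v) : 0 < ∑ a, ∑ b, G.adjMatrix ℤ a b * (h a - h b) ^ 2 := by
  have h0 : ∀ a b, 0 ≤ G.adjMatrix ℤ a b * (h a - h b) ^ 2 := fun a b => by
    rw [SimpleGraph.adjMatrix_apply]
    split_ifs <;> positivity
  refine Finset.sum_pos' (fun a _ => Finset.sum_nonneg fun b _ => h0 a b) ⟨u, mem_univ _, ?_⟩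
  refine Finset.sum_pos' (fun b _ => h0 u b) ⟨v, mem_univ _, ?_⟩
  have : h u - h v ≠ 0 := sub_ne_zero.mpr hne
  rw [SimpleGraph.adjMatrix_apply, if_pos huv]
  positivity

theorem degree_eq_of_adjMatrix_eq {G H : SimpleGraph V} {M : V → V → ℤ}
    (hM : ∀ a b, H.adjMatrix ℤ a b = G.adjMatrix ℤ a b + M a b) (a : V) :
    (H.degree a : ℤ) = G.degree a + ∑ b, M a b := by
  rw [← sum_adjMatrix_eq_degree, ← sum_adjMatrix_eq_degree, ← Finset.sum_add_distrib]
  exact Finset.sum_congr rfl fun b _ => hM a b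

/-- Joining a vertex `v` to a non-neighbour `w`, both of degree at least that of each of their
neighbours, increases the sigma index. -/
theorem exists_sigmaIndex_lt_of_join {G : SimpleGraph V} (hG : G.Connected) {v w : V}
    (hvw : v ≠ w) (hadj : ¬ G.Adj v w) (hv2 : 2 ≤ G.degree v) (hw2 : 2 ≤ G.degree w)
    (hv : ∀ x, G.Adj v x → G.degree x ≤ G.degree v)
    (hw : ∀ x, G.Adj w x → G.degree x ≤ G.degree w) :
    ∃ H : SimpleGraph V, H.Connected ∧ (∀ x, H.degree x = 1 ↔ G.degree x = 1) ∧
      sigmaIndex G < sigmaIndex H := by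
  obtain ⟨H, hH⟩ : ∃ H : SimpleGraph V, H = G ⊔ SimpleGraph.edge v w := ⟨_, rfl⟩
  let M : V → V → ℤ := fun a b =>
    (if a = v ∧ b = w then 1 else 0) + (if a = w ∧ b = v then 1 else 0)
  have hM : ∀ a b, H.adjMatrix ℤ a b = G.adjMatrix ℤ a b + M a b := by
    intro a b
    simp only [SimpleGraph.adjMatrix_apply, hH, M, SimpleGraph.sup_adj, SimpleGraph.edge_adj]
    have := hadj
    have := fun h : G.Adj w v => hadj h.symm
    grind
  have hd : ∀ a, (H.degree a : ℤ) =
      G.degree a + ((if a = v then 1 else 0) + (if a = w then 1 else 0)) := by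
    intro a
    rw [degree_eq_of_adjMatrix_eq hM]
    simp [M, Finset.sum_add_distrib, ite_and]
  refine ⟨H, hG.mono (hH ▸ le_sup_left), fun x => ?_, ?_⟩
  · have := hd x
    grind
  · have key := two_mul_sigmaIndex_perturb G H M _ hM hd
    obtain ⟨x, hx⟩ := (G.degree_pos_iff_exists_adj v).mp (by omega)
    have hQ := adjMatrix_mul_sq_sum_pos G
      (fun a => (if a = v then 1 else 0) + (if a = w then 1 else 0)) hx (by
        have : x ≠ w := by rintro rfl; exact hadj hx
        simp [hvw, hx.ne', this])
    have hnonneg : ∀ y, (∀ x, G.Adj y x → G.degree x ≤ G.degree y) →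
        0 ≤ degreeLaplacian G y := fun y hy => Finset.sum_nonneg fun x _ => by
      rw [SimpleGraph.adjMatrix_apply]
      split_ifs with h
      · have := hy x h
        omega
      · simp
    have hLv := hnonneg v hv
    have hLw := hnonneg w hw
    have hL : ∑ a, ((if a = v then 1 else 0) + (if a = w then 1 else 0)) * degreeLaplacian G a
        = degreeLaplacian G v + degreeLaplacian G w := by
      simp [add_mul, Finset.sum_add_distrib]
    have hE : 0 ≤ ∑ a, ∑ b, M a b * ((H.degree a : ℤ) - H.degree b) ^ 2 :=
      Finset.sum_nonneg fun a _ => Finset.sum_nonneg fun b _ =>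
        mul_nonneg (by simp only [M]; split_ifs <;> simp) (sq_nonneg _)
    rw [hL] at key
    linarith

/-- Shifting a set `S` of neighbours from `u` to an adjacent vertex `v` of locally maximal degree
increases the sigma index, provided that the vertices of `S` have sufficiently small degrees. -/
theorem exists_sigmaIndex_lt_of_shift {G : SimpleGraph V} (hG : G.Connected) {u v : V}
    (huv : G.Adj u v) (hv : ∀ x, G.Adj v x → G.degree x ≤ G.degree v)
    (S T : Finset V) (hS : ∀ x ∈ S, G.Adj u x ∧ x ≠ v ∧ ¬ G.Adj v x) (hne : S.Nonempty)
    (hT : ∀ x, x ∈ T ↔ G.Adj u x ∧ x ≠ v ∧ ¬ G.Adj v x ∧ x ∉ S)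
    (hu : #S + 2 ≤ G.degree u)
    (hSnonneg : 0 ≤ ∑ x ∈ S, ((G.degree u : ℤ) - G.degree x))
    (hST : ∑ x ∈ T, ((G.degree u : ℤ) - G.degree x) ≤ ∑ x ∈ S, ((G.degree u : ℤ) - G.degree x)) :
    ∃ H : SimpleGraph V, H.Connected ∧ (∀ x, H.degree x = 1 ↔ G.degree x = 1) ∧
      sigmaIndex G < sigmaIndex H := by
  have hne' := huv.ne
  have hvS : v ∉ S := fun h => (hS v h).2.1 rfl
  have huS : u ∉ S := fun h => (hS u h).1.ne rfl
  obtain ⟨H, hH⟩ : ∃ H : SimpleGraph V, ∀ a b, H.Adj a b ↔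
      (G.Adj a b ∧ ¬ (a = u ∧ b ∈ S) ∧ ¬ (b = u ∧ a ∈ S)) ∨
        (a = v ∧ b ∈ S) ∨ (b = v ∧ a ∈ S) := ⟨
    { Adj := fun a b => (G.Adj a b ∧ ¬ (a = u ∧ b ∈ S) ∧ ¬ (b = u ∧ a ∈ S)) ∨
        (a = v ∧ b ∈ S) ∨ (b = v ∧ a ∈ S)
      symm := ⟨fun a b h => by have := G.adj_comm a b; tauto⟩
      loopless := ⟨fun a h => by
        rcases h with h | ⟨rfl, h⟩ | ⟨rfl, h⟩
        · exact h.1.ne rfl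
        · exact hvS h
        · exact hvS h⟩ }, fun _ _ => Iff.rfl⟩
  let M : V → V → ℤ := fun a b =>
    (if a = v then if b ∈ S then 1 else 0 else 0) + (if b = v then if a ∈ S then 1 else 0 else 0)
    - (if a = u then if b ∈ S then 1 else 0 else 0) - (if b = u then if a ∈ S then 1 else 0 else 0)
  have hM : ∀ a b, H.adjMatrix ℤ a b = G.adjMatrix ℤ a b + M a b := by
    intro a b
    simp only [SimpleGraph.adjMatrix_apply, hH, M]
    have h1 := hS a
    have h2 := hS b
    have h3 := G.adj_comm a b
    grind
  have hd : ∀ a, (H.degree a : ℤ) = G.degree a +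
      ((if a = v then (#S : ℤ) else 0) - (if a = u then (#S : ℤ) else 0)) := by
    intro a
    rw [degree_eq_of_adjMatrix_eq hM]
    simp only [M, Finset.sum_add_distrib, Finset.sum_sub_distrib, Finset.sum_ite_irrel]
    simp
    ring
  have hvu := hv u huv.symm
  have hspos : 0 < #S := hne.card_pos
  refine ⟨H, connected_of_adj_reachable hG fun a b hab => ?_, fun x => ?_, ?_⟩
  · have huvH : H.Adj u v := (hH u v).2 (Or.inl ⟨huv, by simp [hvS], by simp [hne'.symm]⟩)
    have hvH : ∀ x ∈ S, H.Adj v x := fun x hx =>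
      (hH v x).2 (Or.inr (Or.inl ⟨rfl, hx⟩))
    by_cases h1 : a = u ∧ b ∈ S
    · rw [h1.1]
      exact huvH.reachable.trans (hvH b h1.2).reachable
    by_cases h2 : b = u ∧ a ∈ S
    · rw [h2.1]
      exact (huvH.reachable.trans (hvH a h2.2).reachable).symm
    exact SimpleGraph.Adj.reachable ((hH a b).2 (Or.inl ⟨hab, h1, h2⟩))
  · have := hd x
    grind
  · have key := two_mul_sigmaIndex_perturb G H M _ hM hd
    have hQ := adjMatrix_mul_sq_sum_pos G
      (fun a => (if a = v then (#S : ℤ) else 0) - (if a = u then (#S : ℤ) else 0)) huv (by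
        simp only [if_true, hne', hne'.symm, if_false]
        omega)
    have hL : ∑ a, ((if a = v then (#S : ℤ) else 0) - (if a = u then (#S : ℤ) else 0)) *
        degreeLaplacian G a = #S * (degreeLaplacian G v - degreeLaplacian G u) := by
      simp [sub_mul, Finset.sum_sub_distrib]
      ring
    have hE : ∑ a, ∑ b, M a b * ((H.degree a : ℤ) - H.degree b) ^ 2 =
        2 * ∑ x ∈ S, (((G.degree v : ℤ) + #S - G.degree x) ^ 2
          - ((G.degree u : ℤ) - #S - G.degree x) ^ 2) := by
      have hvd : (H.degree v : ℤ) = G.degree v + #S := by simp [hd, hne'.symm]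
      have hud : (H.degree u : ℤ) = G.degree u - #S := by simp [hd, hne']; ring
      have hxd : ∀ x ∈ S, (H.degree x : ℤ) = G.degree x := fun x hx => by
        have h1 : x ≠ v := by rintro rfl; exact hvS hx
        have h2 : x ≠ u := by rintro rfl; exact huS hx
        simp [hd, h1, h2]
      have e1 : ∑ x ∈ S, (((G.degree v : ℤ) + #S - G.degree x) ^ 2
          - ((G.degree u : ℤ) - #S - G.degree x) ^ 2) =
          ∑ x ∈ S, (((H.degree v : ℤ) - H.degree x) ^ 2 - ((H.degree u : ℤ) - H.degree x) ^ 2) :=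
        Finset.sum_congr rfl fun x hx => by rw [hvd, hud, hxd x hx]
      rw [e1]
      simp only [M, add_mul, sub_mul, Finset.sum_add_distrib, Finset.sum_sub_distrib, ite_mul,
        one_mul, zero_mul, Finset.sum_ite_irrel, Finset.sum_const_zero, Finset.sum_ite_eq',
        Finset.sum_ite_mem, mem_univ, if_true, univ_inter]
      have e2 : ∀ y, ∑ x ∈ S, ((H.degree x : ℤ) - H.degree y) ^ 2 =
          ∑ x ∈ S, ((H.degree y : ℤ) - H.degree x) ^ 2 := fun y =>
        Finset.sum_congr rfl fun x _ => by ring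
      rw [e2, e2]
      ring
    have hLL : 2 * ((G.degree v : ℤ) - G.degree u) - ∑ x ∈ S, ((G.degree u : ℤ) - G.degree x)
        - ∑ x ∈ T, ((G.degree u : ℤ) - G.degree x)
        ≤ degreeLaplacian G v - degreeLaplacian G u := by
      have e1 : 2 * ((G.degree v : ℤ) - G.degree u) - ∑ x ∈ S, ((G.degree u : ℤ) - G.degree x)
          - ∑ x ∈ T, ((G.degree u : ℤ) - G.degree x) =
          ∑ x, ((if x = v then (G.degree v : ℤ) - G.degree u else 0)
            + (if x = u then (G.degree v : ℤ) - G.degree u else 0)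
            - (if x ∈ S then (G.degree u : ℤ) - G.degree x else 0)
            - (if x ∈ T then (G.degree u : ℤ) - G.degree x else 0)) := by
        simp [Finset.sum_add_distrib, Finset.sum_sub_distrib]
        ring
      rw [e1, degreeLaplacian, degreeLaplacian, ← Finset.sum_sub_distrib]
      refine Finset.sum_le_sum fun x _ => ?_
      simp only [SimpleGraph.adjMatrix_apply]
      have h1 := hS x
      have h2 := hT x
      have h3 := hv x
      have h4 := huv.symm
      have h5 := G.loopless.irrefl u
      have h6 := G.loopless.irrefl v
      grind
    have hE2 : ∑ x ∈ S, (((G.degree v : ℤ) + #S - G.degree x) ^ 2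
          - ((G.degree u : ℤ) - #S - G.degree x) ^ 2) =
        ((G.degree v : ℤ) - G.degree u + 2 * #S) * (#S * ((G.degree v : ℤ) - G.degree u) +
          2 * ∑ x ∈ S, ((G.degree u : ℤ) - G.degree x)) := by
      have e1 : (#S : ℤ) * ((G.degree v : ℤ) - G.degree u) =
          ∑ x ∈ S, ((G.degree v : ℤ) - G.degree u) := by
        rw [Finset.sum_const, nsmul_eq_mul]
      rw [e1, Finset.mul_sum, ← Finset.sum_add_distrib, Finset.mul_sum]
      exact Finset.sum_congr rfl fun x _ => by ring
    rw [hL, hE, hE2] at key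
    have hD : (0 : ℤ) ≤ (G.degree v : ℤ) - G.degree u := by omega
    have hs : (0 : ℤ) ≤ #S := by positivity
    generalize (G.degree v : ℤ) - G.degree u = D at *
    generalize ∑ x ∈ S, ((G.degree u : ℤ) - G.degree x) = E at *
    generalize ∑ x ∈ T, ((G.degree u : ℤ) - G.degree x) = F at *
    generalize degreeLaplacian G v - degreeLaplacian G u = L at *
    have p1 := mul_le_mul_of_nonneg_left hLL hs
    have p2 := mul_nonneg hD hSnonneg
    have p3 := mul_nonneg hs (sub_nonneg.mpr hST)
    have p4 := mul_nonneg hs hD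
    have p5 := mul_nonneg p4 hD
    have p6 := mul_nonneg p4 hs
    nlinarith

/-- Reattaching the pendant neighbour `w` of a vertex `u` of degree two to the other
neighbour `v` of `u`, and joining `u` to a further neighbour `z` of `v`, increases the sigma
index. -/
theorem exists_sigmaIndex_lt_of_reattach {G : SimpleGraph V} (hG : G.Connected) {u v w z : V}
    (huv : G.Adj u v) (huw : G.Adj u w) (hvz : G.Adj v z) (hvw : v ≠ w)
    (hnvw : ¬ G.Adj v w) (hzu : z ≠ u) (hnzu : ¬ G.Adj u z)
    (hu : G.degree u = 2) (hw : G.degree w = 1) (hz2 : 2 ≤ G.degree z)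
    (hv : ∀ x, G.Adj v x → G.degree x ≤ G.degree v)
    (hz : ∀ x, G.Adj z x → x ≠ v → G.degree x ≤ G.degree z) :
    ∃ H : SimpleGraph V, H.Connected ∧ (∀ x, H.degree x = 1 ↔ G.degree x = 1) ∧
      sigmaIndex G < sigmaIndex H := by
  have hzw : z ≠ w := by rintro rfl; exact hnvw hvz
  have n1 := huv.ne
  have n2 := huw.ne
  have n3 := hvz.ne
  have hnwv := fun h : G.Adj w v => hnvw h.symm
  have hnuz := fun h : G.Adj z u => hnzu h.symm
  obtain ⟨H, hH⟩ : ∃ H : SimpleGraph V, ∀ a b, H.Adj a b ↔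
      (G.Adj a b ∧ ¬ (a = u ∧ b = w) ∧ ¬ (a = w ∧ b = u)) ∨
        (a = v ∧ b = w) ∨ (a = w ∧ b = v) ∨ (a = u ∧ b = z) ∨ (a = z ∧ b = u) := ⟨
    { Adj := fun a b => (G.Adj a b ∧ ¬ (a = u ∧ b = w) ∧ ¬ (a = w ∧ b = u)) ∨
        (a = v ∧ b = w) ∨ (a = w ∧ b = v) ∨ (a = u ∧ b = z) ∨ (a = z ∧ b = u)
      symm := ⟨fun a b h => by have := G.adj_comm a b; tauto⟩
      loopless := ⟨fun a h => by
        have := G.loopless.irrefl a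
        grind⟩ }, fun _ _ => Iff.rfl⟩
  let M : V → V → ℤ := fun a b =>
    (if a = v then if b = w then 1 else 0 else 0) + (if a = w then if b = v then 1 else 0 else 0)
    + (if a = u then if b = z then 1 else 0 else 0) + (if a = z then if b = u then 1 else 0 else 0)
    - (if a = u then if b = w then 1 else 0 else 0) - (if a = w then if b = u then 1 else 0 else 0)
  have hM : ∀ a b, H.adjMatrix ℤ a b = G.adjMatrix ℤ a b + M a b := by
    intro a b
    simp only [SimpleGraph.adjMatrix_apply, hH, M]
    have h3 := G.adj_comm a b
    grind
  have hd : ∀ a, (H.degree a : ℤ) = G.degree a +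
      ((if a = v then 1 else 0) + (if a = z then 1 else 0)) := by
    intro a
    rw [degree_eq_of_adjMatrix_eq hM]
    simp only [M, Finset.sum_add_distrib, Finset.sum_sub_distrib, Finset.sum_ite_irrel]
    simp
    ring
  have hvu := hv u huv.symm
  refine ⟨H, connected_of_adj_reachable hG fun a b hab => ?_, fun x => ?_, ?_⟩
  · have huvH : H.Adj u v := (hH u v).2 (Or.inl ⟨huv, by simp [hvw], by simp [n2]⟩)
    have hvwH : H.Adj v w := (hH v w).2 (Or.inr (Or.inl ⟨rfl, rfl⟩))
    have huwH := huvH.reachable.trans hvwH.reachable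
    by_cases h1 : a = u ∧ b = w
    · rw [h1.1, h1.2]
      exact huwH
    by_cases h2 : a = w ∧ b = u
    · rw [h2.1, h2.2]
      exact huwH.symm
    exact SimpleGraph.Adj.reachable ((hH a b).2 (Or.inl ⟨hab, h1, h2⟩))
  · have := hd x
    grind
  · have key := two_mul_sigmaIndex_perturb G H M _ hM hd
    have hQ := adjMatrix_mul_sq_sum_nonneg G
      (fun a => (if a = v then 1 else 0) + (if a = z then 1 else 0))
    have hL : ∑ a, ((if a = v then 1 else 0) + (if a = z then 1 else 0)) *
        degreeLaplacian G a = degreeLaplacian G v + degreeLaplacian G z := by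
      simp [add_mul, Finset.sum_add_distrib]
    have hLL : 0 ≤ degreeLaplacian G v + degreeLaplacian G z := by
      have e1 : (0 : ℤ) = ∑ x, ((if x = v then (G.degree z : ℤ) - G.degree v else 0)
            + (if x = z then (G.degree v : ℤ) - G.degree z else 0)) := by
        simp [Finset.sum_add_distrib]
      rw [e1, degreeLaplacian, degreeLaplacian, ← Finset.sum_add_distrib]
      refine Finset.sum_le_sum fun x _ => ?_
      simp only [SimpleGraph.adjMatrix_apply]
      have h2 := hz x
      have h3 := hv x
      have h4 := hvz.symm
      have h5 := G.loopless.irrefl z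
      have h6 := G.loopless.irrefl v
      grind
    have hE : ∑ a, ∑ b, M a b * ((H.degree a : ℤ) - H.degree b) ^ 2 =
        2 * ((G.degree v : ℤ) ^ 2 + (1 - (G.degree z : ℤ)) ^ 2 - 1) := by
      have hvd : (H.degree v : ℤ) = G.degree v + 1 := by simp [hd, n3]
      have hzd : (H.degree z : ℤ) = G.degree z + 1 := by simp [hd, n3.symm]
      have hud : (H.degree u : ℤ) = 2 := by simp [hd, n1, hzu.symm, hu]
      have hwd : (H.degree w : ℤ) = 1 := by simp [hd, hvw.symm, hzw.symm, hw]
      simp only [M, add_mul, sub_mul, Finset.sum_add_distrib, Finset.sum_sub_distrib, ite_mul,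
        one_mul, zero_mul, Finset.sum_ite_irrel, Finset.sum_const_zero, Finset.sum_ite_eq',
        mem_univ, if_true, hvd, hzd, hud, hwd]
      ring
    rw [hL, hE] at key
    have : (2 : ℤ) ≤ G.degree v := by omega
    nlinarith [sq_nonneg (1 - (G.degree z : ℤ))]

/-- In a graph whose sigma index cannot be increased, a vertex `w` at distance two from a vertex
`v` of maximum degree has larger degree than its neighbours in the neighbourhood of `v`, apart
from one exceptional configuration. -/
theorem degree_lt_of_sigmaIndex_maximal {G : SimpleGraph V} (hG : G.Connected) {u v w : V}
    (hmax : ∀ H : SimpleGraph V, H.Connected → (∀ x, H.degree x = 1 ↔ G.degree x = 1) →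
      sigmaIndex H ≤ sigmaIndex G)
    (hv : ∀ x, G.degree x ≤ G.degree v) (huv : G.Adj u v) (huw : G.Adj u w) (hwv : w ≠ v)
    (hnvw : ¬ G.Adj v w) : G.degree u < G.degree w ∨ (G.degree u = 2 ∧ G.degree w ≤ 2) := by
  by_contra! hcon
  obtain ⟨hle, hcon⟩ := hcon
  have hnot : ¬ ∃ H : SimpleGraph V, H.Connected ∧ (∀ x, H.degree x = 1 ↔ G.degree x = 1) ∧
      sigmaIndex G < sigmaIndex H := by
    rintro ⟨H, h1, h2, h3⟩
    exact absurd (hmax H h1 h2) (not_le.mpr h3)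
  set S₀ : Finset V := univ.filter fun x =>
    G.Adj u x ∧ x ≠ v ∧ ¬ G.Adj v x ∧ G.degree x ≤ G.degree u with hS₀
  have hwS : w ∈ S₀ := by simp [hS₀, huw, hwv, hnvw, hle]
  have hvS : v ∉ S₀ := by simp [hS₀]
  have hsub : insert v S₀ ⊆ G.neighborFinset u := by
    intro x hx
    rw [mem_insert] at hx
    rcases hx with rfl | hx
    · simpa using huv
    · simp only [hS₀, mem_filter] at hx
      simpa using hx.2.1
  have hcard := card_le_card hsub
  rw [card_insert_of_notMem hvS, SimpleGraph.card_neighborFinset_eq_degree] at hcard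
  have hpos : ∀ x ∈ S₀, (0 : ℤ) ≤ (G.degree u : ℤ) - G.degree x := by
    intro x hx
    simp only [hS₀, mem_filter] at hx
    omega
  by_cases hu : #S₀ + 2 ≤ G.degree u
  · refine hnot (exists_sigmaIndex_lt_of_shift hG huv (fun x _ => hv x) S₀
      (univ.filter fun x => G.Adj u x ∧ x ≠ v ∧ ¬ G.Adj v x ∧ x ∉ S₀) (fun x hx => ?_) ⟨w, hwS⟩
      (fun x => by simp) hu (Finset.sum_nonneg hpos) ?_)
    · simp only [hS₀, mem_filter] at hx
      tauto
    · refine le_trans (Finset.sum_nonpos fun x hx => ?_) (Finset.sum_nonneg hpos)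
      simp only [hS₀, mem_filter, mem_univ, true_and] at hx
      have : ¬ G.degree x ≤ G.degree u := by tauto
      omega
  · have hcu : G.degree u = #S₀ + 1 := by omega
    have hNu : insert v S₀ = G.neighborFinset u := by
      refine eq_of_subset_of_card_le hsub ?_
      rw [card_insert_of_notMem hvS, SimpleGraph.card_neighborFinset_eq_degree, hcu]
    have hS2 : 1 < #S₀ := by
      have : 0 < #S₀ := card_pos.mpr ⟨w, hwS⟩
      omega
    obtain ⟨y, hy, hymax⟩ := exists_max_image S₀ (fun x => G.degree x) ⟨w, hwS⟩
    obtain ⟨b, hb, hby⟩ := exists_mem_ne hS2 y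
    have hbS : b ∈ S₀.erase y := mem_erase.mpr ⟨hby, hb⟩
    have hpos' : ∀ x ∈ S₀.erase y, (0 : ℤ) ≤ (G.degree u : ℤ) - G.degree x :=
      fun x hx => hpos x (mem_of_mem_erase hx)
    refine hnot (exists_sigmaIndex_lt_of_shift hG huv (fun x _ => hv x) (S₀.erase y) {y}
      (fun x hx => ?_) ⟨b, hbS⟩ (fun x => ?_) ?_ (Finset.sum_nonneg hpos') ?_)
    · have := mem_of_mem_erase hx
      simp only [hS₀, mem_filter] at this
      tauto
    · have hx : x ∈ insert v S₀ ↔ G.Adj u x := by rw [hNu]; simp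
      have hy' := hy
      simp only [hS₀, mem_filter] at hy'
      grind
    · rw [card_erase_of_mem hy]
      omega
    · rw [sum_singleton]
      refine le_trans ?_ (single_le_sum hpos' hbS)
      have := hymax b hb
      omega

theorem adj_of_sigmaIndex_maximal {G : SimpleGraph V} (hG : G.Connected) {v : V}
    (hmax : ∀ H : SimpleGraph V, H.Connected → (∀ x, H.degree x = 1 ↔ G.degree x = 1) →
      sigmaIndex H ≤ sigmaIndex G)
    (hcard : 3 ≤ #(univ.filter fun x => G.degree x ≠ 1))
    (hv : ∀ x, G.degree x ≤ G.degree v) {x : V} (hx : x ≠ v) : G.Adj v x := by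
  by_contra hnx
  have hnot : ¬ ∃ H : SimpleGraph V, H.Connected ∧ (∀ x, H.degree x = 1 ↔ G.degree x = 1) ∧
      sigmaIndex G < sigmaIndex H := by
    rintro ⟨H, h1, h2, h3⟩
    exact absurd (hmax H h1 h2) (not_le.mpr h3)
  have hshift {u w : V} := degree_lt_of_sigmaIndex_maximal (u := u) (w := w) hG hmax hv
  obtain ⟨w, hw, hwmax⟩ := exists_max_image (univ.filter fun y => y ≠ v ∧ ¬ G.Adj v y)
    (fun y => G.degree y) ⟨x, by simp [hx, hnx]⟩
  simp only [mem_filter, mem_univ, true_and] at hw hwmax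
  obtain ⟨hwv, hnvw⟩ := hw
  by_cases hw2 : 2 ≤ G.degree w
  · refine hnot (exists_sigmaIndex_lt_of_join hG hwv.symm hnvw (hw2.trans (hv w)) hw2
      (fun x _ => hv x) fun y hy => ?_)
    by_cases hvy : G.Adj v y
    · rcases hshift hvy.symm hy.symm hwv hnvw with h | h <;> omega
    · exact hwmax y ⟨fun h => hnvw (h ▸ hy.symm), hvy⟩
  · obtain ⟨u, t, huv, hut, htv, hnvt⟩ := exists_adj_of_not_dominating hG hx hnx
    have hout : ∀ y, y ≠ v → ¬ G.Adj v y → G.degree y ≤ 1 := fun y h1 h2 => by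
      have := hwmax y ⟨h1, h2⟩
      omega
    have ht1 : G.degree t = 1 := by
      have := hout t htv hnvt
      have := (G.degree_pos_iff_exists_adj t).mpr ⟨u, hut.symm⟩
      omega
    have hsub : ({v, t} : Finset V) ⊆ G.neighborFinset u := by
      intro y hy
      rw [mem_insert, mem_singleton] at hy
      rcases hy with rfl | rfl <;> simpa
    have hpair : #({v, t} : Finset V) = 2 := card_pair htv.symm
    have hu2 : G.degree u = 2 := by
      have := card_le_card hsub
      rw [SimpleGraph.card_neighborFinset_eq_degree] at this
      rcases hshift huv hut htv hnvt with h | h <;> omega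
    have hNu : ({v, t} : Finset V) = G.neighborFinset u := by
      refine eq_of_subset_of_card_le hsub ?_
      rw [SimpleGraph.card_neighborFinset_eq_degree, hu2, hpair]
    obtain ⟨c, hc, hcuv⟩ := exists_mem_notMem_of_card_lt_card
      (lt_of_le_of_lt (card_le_two (a := u) (b := v)) hcard)
    simp only [mem_filter, mem_univ, true_and, mem_insert, mem_singleton, not_or] at hc hcuv
    have := hG.nonempty
    have : Nontrivial V := ⟨u, v, huv.ne⟩
    have hcpos := hG.preconnected.degree_pos_of_nontrivial c
    have hvc : G.Adj v c := by
      by_contra h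
      have := hout c hcuv.2 h
      omega
    obtain ⟨z, hz, hzmax⟩ := exists_max_image (univ.filter fun y => y ≠ u ∧ G.Adj v y)
      (fun y => G.degree y) ⟨c, by simp [hcuv, hvc]⟩
    simp only [mem_filter, mem_univ, true_and] at hz hzmax
    obtain ⟨hzu, hvz⟩ := hz
    have hz2 : 2 ≤ G.degree z := by
      have := hzmax c ⟨hcuv.1, hvc⟩
      omega
    have hnuz : ¬ G.Adj u z := by
      rw [← SimpleGraph.mem_neighborFinset, ← hNu, mem_insert, mem_singleton]
      rintro (rfl | rfl)
      · exact hvz.ne rfl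
      · exact hnvt hvz
    refine hnot (exists_sigmaIndex_lt_of_reattach hG huv hut hvz htv.symm hnvt hzu hnuz hu2 ht1 hz2
      (fun x _ => hv x) fun y hy hyv => ?_)
    by_cases hvy : G.Adj v y
    · exact hzmax y ⟨fun h => hnuz (h ▸ hy.symm), hvy⟩
    · exact (hout y hyv hvy).trans (by omega)

/-- If a connected graph `G` with `n` vertices and exactly `p` pendant vertices
(`1 ≤ p ≤ n - 3`) has maximal sigma index among all connected graphs with `n`
vertices and `p` pendant vertices, then its maximum degree is `n - 1`. -/
theorem stmt12 (n p : ℕ) (hp : 1 ≤ p) (hpn : p ≤ n - 3)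
    (G : SimpleGraph (Fin n)) (hG : G.Connected)
    (hpend : ((univ : Finset (Fin n)).filter fun v => G.degree v = 1).card = p)
    (hmax : ∀ H : SimpleGraph (Fin n), H.Connected →
      ((univ : Finset (Fin n)).filter fun v => H.degree v = 1).card = p →
      sigmaIndex H ≤ sigmaIndex G) :
    G.maxDegree = n - 1 := by
  have := hG.nonempty
  obtain ⟨v, hv⟩ := G.exists_maximal_degree_vertex
  have hcard : 3 ≤ #(univ.filter fun x => G.degree x ≠ 1) := by
    have := card_filter_add_card_filter_not (s := (univ : Finset (Fin n)))
      (fun x => G.degree x = 1)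
    simp only [card_univ, Fintype.card_fin, ← ne_eq] at this
    omega
  have hdom : ∀ x, x ≠ v → G.Adj v x := fun x hx =>
    adj_of_sigmaIndex_maximal hG
      (fun H hH hdeg => hmax H hH (by simpa only [hdeg] using hpend)) hcard
      (fun x => hv ▸ G.degree_le_maxDegree x) hx
  have hN : G.neighborFinset v = univ.erase v := by
    ext x
    simp only [SimpleGraph.mem_neighborFinset, mem_erase, mem_univ, and_true]
    exact ⟨fun h => h.ne', hdom x⟩
  rw [hv, ← SimpleGraph.card_neighborFinset_eq_degree, hN, card_erase_of_mem (mem_univ v)]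
  simp
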